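/- Let ω_AB be a state of a finite-dimensional bipartite system and V_A an operator on H_A with ‖V_A‖ ≤ 1. Setting ω̃_AB = (V_A ⊗ I_B) ω_AB (V_A* ⊗ I_B), one has 0 ≤ I(A:B)_ω − I(A:B)_ω̃ ≤ 2[H(ω_A) − H(V_A ω_A V_A*)], where the mutual information of the (subnormalized) operator ω̃ is defined by I(A:B)_ω̃ = (Tr ω̃) · I(A:B)_{ω̃/Tr ω̃} and H is extended to positive operators by H(ρ) = Tr η(ρ) − η(Tr ρ) with η(x) = −x log x. -/

import Mathlib

open scoped BigOperators Kronecker ComplexOrder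
open Matrix

noncomputable section

def binEnt (l : ℝ) : ℝ := Real.negMulLog l + Real.negMulLog (1 - l)

def vN {n : Type*} [Fintype n] [DecidableEq n] (ρ : Matrix n n ℂ) : ℝ :=
  if h : ρ.IsHermitian then ∑ i, Real.negMulLog (h.eigenvalues i) else 0

def IsDensity {n : Type*} [Fintype n] [DecidableEq n] (ρ : Matrix n n ℂ) : Prop :=
  ρ.PosSemidef ∧ ρ.trace = 1

def IsPure {n : Type*} (ρ : Matrix n n ℂ) : Prop :=
  ∃ v : n → ℂ, ρ = Matrix.vecMulVec v (star v)

def ptrB {a b : Type*} [Fintype b] (ρ : Matrix (a × b) (a × b) ℂ) : Matrix a a ℂ :=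
  Matrix.of fun i i' => ∑ j, ρ (i, j) (i', j)

def ptrA {a b : Type*} [Fintype a] (ρ : Matrix (a × b) (a × b) ℂ) : Matrix b b ℂ :=
  Matrix.of fun j j' => ∑ i, ρ (i, j) (i, j')

def mutInfo {a b : Type*} [Fintype a] [Fintype b] [DecidableEq a] [DecidableEq b]
    (ρ : Matrix (a × b) (a × b) ℂ) : ℝ :=
  vN (ptrB ρ) + vN (ptrA ρ) - vN ρ

/- tripartite, index a × b × e -/
def tr3C {a b e : Type*} [Fintype e] (ρ : Matrix (a × b × e) (a × b × e) ℂ) :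
    Matrix (a × b) (a × b) ℂ :=
  Matrix.of fun x y => ∑ k, ρ (x.1, x.2, k) (y.1, y.2, k)

def tr3B {a b e : Type*} [Fintype b] (ρ : Matrix (a × b × e) (a × b × e) ℂ) :
    Matrix (a × e) (a × e) ℂ :=
  Matrix.of fun x y => ∑ j, ρ (x.1, j, x.2) (y.1, j, y.2)

def tr3A {a b e : Type*} [Fintype a] (ρ : Matrix (a × b × e) (a × b × e) ℂ) :
    Matrix (b × e) (b × e) ℂ :=
  Matrix.of fun x y => ∑ i, ρ (i, x.1, x.2) (i, y.1, y.2)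

def m3A {a b e : Type*} [Fintype b] [Fintype e] (ρ : Matrix (a × b × e) (a × b × e) ℂ) :
    Matrix a a ℂ :=
  Matrix.of fun i i' => ∑ j, ∑ k, ρ (i, j, k) (i', j, k)

def m3B {a b e : Type*} [Fintype a] [Fintype e] (ρ : Matrix (a × b × e) (a × b × e) ℂ) :
    Matrix b b ℂ :=
  Matrix.of fun j j' => ∑ i, ∑ k, ρ (i, j, k) (i, j', k)

def m3C {a b e : Type*} [Fintype a] [Fintype b] (ρ : Matrix (a × b × e) (a × b × e) ℂ) :
    Matrix e e ℂ :=
  Matrix.of fun k k' => ∑ i, ∑ j, ρ (i, j, k) (i, j, k')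

/-- conditional mutual information I(A:B|E) for a state on a × b × e -/
def cmi3 {a b e : Type*} [Fintype a] [Fintype b] [Fintype e]
    [DecidableEq a] [DecidableEq b] [DecidableEq e]
    (ρ : Matrix (a × b × e) (a × b × e) ℂ) : ℝ :=
  vN (tr3B ρ) + vN (tr3A ρ) - vN (m3C ρ) - vN ρ

/-- entropy extended to positive trace-class operators: H(ρ)=Tr η(ρ) − η(Tr ρ) -/
def entExt {n : Type*} [Fintype n] [DecidableEq n] (ρ : Matrix n n ℂ) : ℝ :=
  vN ρ - Real.negMulLog ρ.trace.re

/-- mutual information extended homogeneously: I(ω) = (Tr ω)·I(ω / Tr ω) -/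
def mutInfoExt {a b : Type*} [Fintype a] [Fintype b] [DecidableEq a] [DecidableEq b]
    (ω : Matrix (a × b) (a × b) ℂ) : ℝ :=
  ω.trace.re * mutInfo (((ω.trace.re : ℂ))⁻¹ • ω)

/-! ### Spectral data -/

/-- spectral data of a positive semidefinite matrix -/
structure Spec {n : Type*} [Fintype n] [DecidableEq n] (ρ U : Matrix n n ℂ) (p : n → ℝ) : Prop where
  left : Uᴴ * U = 1
  right : U * Uᴴ = 1
  eq : ρ = U * diagonal (fun i => (p i : ℂ)) * Uᴴ
  nn : ∀ i, 0 ≤ p i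

lemma vN_roots {n : Type*} [Fintype n] [DecidableEq n] {ρ : Matrix n n ℂ} (h : ρ.IsHermitian) :
    vN ρ = (ρ.charpoly.roots.map (fun z => Real.negMulLog z.re)).sum := by
  rw [vN, dif_pos h, h.roots_charpoly_eq_eigenvalues]
  simp

lemma Spec.psd {n : Type*} [Fintype n] [DecidableEq n] {ρ U : Matrix n n ℂ} {p : n → ℝ}
    (h : Spec ρ U p) : ρ.PosSemidef := by
  rw [h.eq]
  apply PosSemidef.mul_mul_conjTranspose_same
  apply PosSemidef.diagonal
  intro i
  simpa using h.nn i

lemma Spec.vN {n : Type*} [Fintype n] [DecidableEq n] {ρ U : Matrix n n ℂ} {p : n → ℝ}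
    (h : Spec ρ U p) : vN ρ = ∑ i, Real.negMulLog (p i) := by
  rw [vN_roots h.psd.1]
  conv_lhs => rw [h.eq, charpoly_mul_comm, ← mul_assoc, h.left, one_mul, charpoly_diagonal]
  rw [Polynomial.roots_prod]
  · simp
  · simp [Finset.prod_ne_zero_iff, Polynomial.X_sub_C_ne_zero]

lemma Spec.trace {n : Type*} [Fintype n] [DecidableEq n] {ρ U : Matrix n n ℂ} {p : n → ℝ}
    (h : Spec ρ U p) : ρ.trace.re = ∑ i, p i := by
  conv_lhs => rw [h.eq, trace_mul_comm, ← mul_assoc, h.left, one_mul, trace_diagonal]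
  simp

lemma exists_spec {n : Type*} [Fintype n] [DecidableEq n] {ρ : Matrix n n ℂ}
    (h : ρ.PosSemidef) : ∃ U p, Spec ρ U p := by
  refine ⟨h.1.eigenvectorUnitary, h.1.eigenvalues, ?_, ?_, ?_, h.eigenvalues_nonneg⟩
  · exact Unitary.coe_star_mul_self _
  · exact Unitary.coe_mul_star_self _
  · conv_lhs => rw [h.1.spectral_theorem, Unitary.conjStarAlgAut_apply]
    rfl

lemma psd_factor {n : Type*} [Fintype n] [DecidableEq n] {ρ : Matrix n n ℂ}
    (h : ρ.PosSemidef) : ∃ L : Matrix n n ℂ, ρ = Lᴴ * L := by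
  obtain ⟨U, p, hs⟩ := exists_spec h
  refine ⟨diagonal (fun i => (Real.sqrt (p i) : ℂ)) * Uᴴ, ?_⟩
  rw [conjTranspose_mul, conjTranspose_conjTranspose, diagonal_conjTranspose, mul_assoc,
    ← mul_assoc (diagonal _) (diagonal _), diagonal_mul_diagonal, ← mul_assoc]
  conv_lhs => rw [hs.eq]
  congr 3
  ext i
  simp only [Pi.star_apply, RCLike.star_def, Complex.conj_ofReal]
  rw [← Complex.ofReal_mul, Real.mul_self_sqrt (hs.nn i)]

lemma trace_sq_nonneg {m n : Type*} [Fintype n] [Fintype m] (X : Matrix m n ℂ) :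
    0 ≤ (Xᴴ * X).trace.re := by
  have := (posSemidef_conjTranspose_mul_self X).trace_nonneg
  exact (Complex.le_def.1 this).1

lemma contr_ineq {n : Type*} [Fintype n] [DecidableEq n]
    {K L : Matrix n n ℂ} (hKL : Kᴴ * K + Lᴴ * L = 1) (P Q : Matrix n n ℂ) :
    ((Kᴴ * P + Lᴴ * Q)ᴴ * (Kᴴ * P + Lᴴ * Q)).trace.re ≤
      (Pᴴ * P).trace.re + (Qᴴ * Q).trace.re := by
  set X := Kᴴ * P + Lᴴ * Q with hX
  have hXh : Xᴴ = Pᴴ * K + Qᴴ * L := by simp [hX]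
  have e : Pᴴ * P + Qᴴ * Q - Xᴴ * X =
      (P - K * X)ᴴ * (P - K * X) + (Q - L * X)ᴴ * (Q - L * X) := by
    have h1 : Xᴴ * X = Pᴴ * (K * X) + Qᴴ * (L * X) := by
      rw [hXh, add_mul, mul_assoc, mul_assoc]
    have h2 : Xᴴ * X = Xᴴ * Kᴴ * P + Xᴴ * Lᴴ * Q := by
      conv_lhs => enter [2]; rw [hX]
      rw [mul_add]
      simp only [mul_assoc]
    have h3 : Xᴴ * X = Xᴴ * Kᴴ * (K * X) + Xᴴ * Lᴴ * (L * X) := by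
      calc Xᴴ * X = Xᴴ * ((1 : Matrix n n ℂ) * X) := by simp
        _ = _ := by rw [← hKL]; simp only [add_mul, mul_add, mul_assoc]
    simp only [conjTranspose_sub, conjTranspose_mul, sub_mul, mul_sub]
    have e1 : Pᴴ * P + Qᴴ * Q - Xᴴ * X = Pᴴ * P + Qᴴ * Q - Xᴴ * X - Xᴴ * X + Xᴴ * X := by abel
    rw [e1]
    nth_rw 1 [h1]; nth_rw 1 [h2]; nth_rw 1 [h3]
    abel
  have h1 := trace_sq_nonneg (P - K * X)
  have h2 := trace_sq_nonneg (Q - L * X)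
  have h3 := congrArg (fun M => (Matrix.trace M).re) e
  simp only [trace_add, trace_sub, Complex.add_re, Complex.sub_re] at h3
  linarith

/-! ### Calculus -/

def Gfun {ι : Type*} [Fintype ι] (c p q : ι → ℝ) (T : ℝ) : ℝ :=
  ∑ k, c k * p k * (Real.log (q k + T * p k) - Real.log (q k) - Real.log (1 + T))

def Ffun {ι : Type*} [Fintype ι] (c p q : ι → ℝ) (s : ℝ) : ℝ :=
  ∑ k, c k * (p k ^ 2 / (q k + s * p k))

lemma Gfun_zero {ι : Type*} [Fintype ι] (c p q : ι → ℝ) : Gfun c p q 0 = 0 := by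
  simp [Gfun]

lemma Gfun_deriv {ι : Type*} [Fintype ι] (c p q : ι → ℝ) (hp : ∀ k, 0 ≤ p k) (hq : ∀ k, 0 ≤ q k)
    (T : ℝ) (hT : 0 < T) :
    HasDerivAt (Gfun c p q) (Ffun c p q T - (∑ k, c k * p k) / (1 + T)) T := by
  have e : Ffun c p q T - (∑ k, c k * p k) / (1 + T) =
      ∑ k, c k * p k * (p k / (q k + T * p k) - 1 / (1 + T)) := by
    rw [Ffun, Finset.sum_div, ← Finset.sum_sub_distrib]
    refine Finset.sum_congr rfl fun k _ => ?_
    ring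
  rw [e]
  unfold Gfun
  refine HasDerivAt.fun_sum fun k _ => ?_
  rcases (hp k).eq_or_lt with h | h
  · simp only [← h, mul_zero, zero_mul]
    exact hasDerivAt_const _ _
  · refine HasDerivAt.const_mul _ ?_
    have h1 : HasDerivAt (fun T => q k + T * p k) (p k) T := by
      simpa using ((hasDerivAt_id T).mul_const (p k)).const_add (q k)
    have h2 : HasDerivAt (fun T : ℝ => 1 + T) 1 T := by
      simpa using (hasDerivAt_id T).const_add (1 : ℝ)
    have h3 : q k + T * p k ≠ 0 := by
      have := hq k
      positivity
    have h4 : 1 + T ≠ 0 := by positivity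
    exact ((h1.log h3).sub_const _).sub (h2.log h4)

lemma Gfun_cont {ι : Type*} [Fintype ι] (c p q : ι → ℝ) (hp : ∀ k, 0 ≤ p k) (hq : ∀ k, 0 ≤ q k)
    (hs : ∀ k, q k = 0 → c k * p k = 0) :
    ContinuousOn (Gfun c p q) (Set.Ici 0) := by
  unfold Gfun
  refine continuousOn_finsetSum _ fun k _ => ?_
  rcases (hq k).eq_or_lt with h | h
  · simp only [hs k h.symm, zero_mul]
    exact continuousOn_const
  · refine ContinuousOn.mul continuousOn_const ?_
    refine ContinuousOn.sub (ContinuousOn.sub ?_ continuousOn_const) ?_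
    · refine ContinuousOn.log (by fun_prop) ?_
      intro x hx
      have : 0 ≤ x := hx
      have := hp k
      positivity
    · refine ContinuousOn.log (by fun_prop) ?_
      intro x hx
      have : 0 ≤ x := hx
      positivity

open Filter Topology in
lemma Gfun_lim {ι : Type*} [Fintype ι] (c p q : ι → ℝ) (hp : ∀ k, 0 ≤ p k) (hq : ∀ k, 0 ≤ q k) :
    Tendsto (Gfun c p q) atTop (𝓝 (∑ k, c k * p k * (Real.log (p k) - Real.log (q k)))) := by
  unfold Gfun
  refine tendsto_finsetSum _ fun k _ => ?_
  rcases (hp k).eq_or_lt with h | h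
  · simp [← h]
  · refine Tendsto.const_mul _ ?_
    have h1 : Tendsto (fun T : ℝ => p k + (q k - p k) / (1 + T)) atTop (𝓝 (p k + 0)) := by
      refine tendsto_const_nhds.add ?_
      exact tendsto_const_nhds.div_atTop (tendsto_atTop_add_const_left _ _ tendsto_id)
    rw [add_zero] at h1
    have h2 := (h1.log h.ne').sub_const (Real.log (q k))
    refine h2.congr' ?_
    filter_upwards [eventually_gt_atTop 0] with T hT
    have h3 : q k + T * p k ≠ 0 := by
      have := hq k
      positivity
    have h4 : 1 + T ≠ 0 := by positivity
    have : p k + (q k - p k) / (1 + T) = (q k + T * p k) / (1 + T) := by field_simp; ring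
    rw [this, Real.log_div h3 h4]
    ring

lemma rel_mono {ι κ : Type*} [Fintype ι] [Fintype κ] (c p q : ι → ℝ) (c' p' q' : κ → ℝ)
    (hp : ∀ k, 0 ≤ p k) (hq : ∀ k, 0 ≤ q k) (hs : ∀ k, q k = 0 → c k * p k = 0)
    (hp' : ∀ k, 0 ≤ p' k) (hq' : ∀ k, 0 ≤ q' k) (hs' : ∀ k, q' k = 0 → c' k * p' k = 0)
    (h : ∀ s, 0 < s → Ffun c' p' q' s - (∑ k, c' k * p' k) / (1 + s) ≤
      Ffun c p q s - (∑ k, c k * p k) / (1 + s)) :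
    ∑ k, c' k * p' k * (Real.log (p' k) - Real.log (q' k)) ≤
      ∑ k, c k * p k * (Real.log (p k) - Real.log (q k)) := by
  have hm : MonotoneOn (fun T => Gfun c p q T - Gfun c' p' q' T) (Set.Ici 0) := by
    refine monotoneOn_of_hasDerivWithinAt_nonneg (convex_Ici 0)
      ((Gfun_cont c p q hp hq hs).sub (Gfun_cont c' p' q' hp' hq' hs'))
      (f' := fun s => (Ffun c p q s - (∑ k, c k * p k) / (1 + s)) -
        (Ffun c' p' q' s - (∑ k, c' k * p' k) / (1 + s))) ?_ ?_
    · intro x hx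
      rw [interior_Ici] at hx
      exact ((Gfun_deriv c p q hp hq x hx).sub (Gfun_deriv c' p' q' hp' hq' x hx)).hasDerivWithinAt
    · intro x hx
      rw [interior_Ici] at hx
      exact sub_nonneg.2 (h x hx)
  refine le_of_tendsto_of_tendsto (Gfun_lim c' p' q' hp' hq') (Gfun_lim c p q hp hq) ?_
  filter_upwards [Filter.eventually_ge_atTop 0] with T hT
  have := hm (Set.self_mem_Ici) (show T ∈ Set.Ici 0 from hT) hT
  simp only [Gfun_zero] at this
  linarith

/-! ### The variational functional -/

def ov {n : Type*} [Fintype n] (U W : Matrix n n ℂ) (k : n × n) : ℝ :=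
  Complex.normSq ((Uᴴ * W) k.1 k.2)

def Phi {n : Type*} [Fintype n] (s : ℝ) (ρ σ Y : Matrix n n ℂ) : ℝ :=
  2 * (ρ * Y).trace.re - (Y * σ * Yᴴ).trace.re - s * (Yᴴ * ρ * Y).trace.re

lemma Phi_eq {n : Type*} [Fintype n] [DecidableEq n] {ρ σ U W : Matrix n n ℂ} {p q : n → ℝ}
    (h1 : Spec ρ U p) (h2 : Spec σ W q) (s : ℝ) (Y : Matrix n n ℂ) :
    Phi s ρ σ Y = ∑ k : n × n, (2 * (p k.1 * ((Uᴴ * Y * W) k.1 k.2 *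
      (starRingEnd ℂ) ((Uᴴ * W) k.1 k.2)).re) -
      (q k.2 + s * p k.1) * Complex.normSq ((Uᴴ * Y * W) k.1 k.2)) := by
  have e1 : (ρ * Y).trace = (diagonal (fun i => (p i : ℂ)) * ((Uᴴ * Y * W) * (Uᴴ * W)ᴴ)).trace := by
    rw [h1.eq, conjTranspose_mul, conjTranspose_conjTranspose, mul_assoc (Uᴴ * Y), ← mul_assoc W,
      h2.right, one_mul, mul_assoc, mul_assoc, trace_mul_comm]
    simp only [mul_assoc]
  have e2 : (Y * σ * Yᴴ).trace =
      ((Uᴴ * Y * W) * diagonal (fun i => (q i : ℂ)) * (Uᴴ * Y * W)ᴴ).trace := by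
    rw [h2.eq]
    simp only [conjTranspose_mul, conjTranspose_conjTranspose]
    conv_rhs => rw [mul_assoc Uᴴ, mul_assoc Uᴴ, mul_assoc Uᴴ, trace_mul_comm]
    simp only [mul_assoc]
    rw [h1.right, mul_one]
  have e3 : (Yᴴ * ρ * Y).trace =
      ((Uᴴ * Y * W)ᴴ * (diagonal (fun i => (p i : ℂ)) * (Uᴴ * Y * W))).trace := by
    rw [h1.eq]
    simp only [conjTranspose_mul, conjTranspose_conjTranspose]
    conv_rhs => rw [mul_assoc Wᴴ, trace_mul_comm]
    simp only [mul_assoc]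
    rw [h2.right, mul_one]
  rw [Phi, e1, e2, e3]
  generalize Uᴴ * Y * W = Z
  generalize Uᴴ * W = u
  have f1 : (diagonal (fun i => (p i : ℂ)) * (Z * uᴴ)).trace.re =
      ∑ k : n × n, p k.1 * (Z k.1 k.2 * (starRingEnd ℂ) (u k.1 k.2)).re := by
    rw [Fintype.sum_prod_type]
    simp only [trace, diag_apply, diagonal_mul, Complex.re_sum, Complex.re_ofReal_mul,
      Matrix.mul_apply (M := Z), conjTranspose_apply, Finset.mul_sum, RCLike.star_def]
  have f2 : (Z * diagonal (fun i => (q i : ℂ)) * Zᴴ).trace.re =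
      ∑ k : n × n, q k.2 * Complex.normSq (Z k.1 k.2) := by
    rw [Fintype.sum_prod_type]
    simp only [trace, diag_apply, Matrix.mul_apply (M := Z * diagonal _), mul_diagonal,
      Complex.re_sum, conjTranspose_apply, RCLike.star_def]
    refine Finset.sum_congr rfl fun i _ => Finset.sum_congr rfl fun j _ => ?_
    rw [mul_right_comm, Complex.mul_conj, ← Complex.ofReal_mul, Complex.ofReal_re, mul_comm]
  have f3 : (Zᴴ * (diagonal (fun i => (p i : ℂ)) * Z)).trace.re =
      ∑ k : n × n, p k.1 * Complex.normSq (Z k.1 k.2) := by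
    rw [Fintype.sum_prod_type, Finset.sum_comm]
    simp only [trace, diag_apply, Matrix.mul_apply (M := Zᴴ), diagonal_mul,
      Complex.re_sum, conjTranspose_apply, RCLike.star_def]
    refine Finset.sum_congr rfl fun i _ => Finset.sum_congr rfl fun j _ => ?_
    rw [mul_left_comm, mul_comm ((starRingEnd ℂ) _), Complex.mul_conj, ← Complex.ofReal_mul,
      Complex.ofReal_re]
  rw [f1, f2, f3, Finset.mul_sum, Finset.mul_sum, ← Finset.sum_sub_distrib,
    ← Finset.sum_sub_distrib]
  refine Finset.sum_congr rfl fun k _ => ?_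
  ring

lemma term_le (p d : ℝ) (hd : 0 ≤ d) (h0 : d = 0 → p = 0) (z u : ℂ) :
    2 * (p * (z * (starRingEnd ℂ) u).re) - d * Complex.normSq z ≤
      Complex.normSq u * (p ^ 2 / d) := by
  rcases hd.eq_or_lt with h | h
  · simp [h0 h.symm, ← h]
  · rw [← mul_div_assoc, le_div_iff₀ h]
    simp only [Complex.normSq_apply, Complex.mul_re, Complex.conj_re, Complex.conj_im]
    nlinarith [sq_nonneg (d * z.re - p * u.re), sq_nonneg (d * z.im - p * u.im)]

lemma Phi_le {n : Type*} [Fintype n] [DecidableEq n] {ρ σ U W : Matrix n n ℂ} {p q : n → ℝ}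
    (h1 : Spec ρ U p) (h2 : Spec σ W q) (s : ℝ) (hs : 0 < s) (Y : Matrix n n ℂ) :
    Phi s ρ σ Y ≤ Ffun (ov U W) (fun k => p k.1) (fun k => q k.2) s := by
  rw [Phi_eq h1 h2, Ffun]
  refine Finset.sum_le_sum fun k _ => ?_
  have hp := h1.nn k.1
  have hq := h2.nn k.2
  refine term_le _ _ (by positivity) ?_ _ _
  intro h
  have : s * p k.1 = 0 := le_antisymm (by linarith) (by positivity)
  simpa [hs.ne'] using this

lemma Phi_max {n : Type*} [Fintype n] [DecidableEq n] {ρ σ U W : Matrix n n ℂ} {p q : n → ℝ}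
    (h1 : Spec ρ U p) (h2 : Spec σ W q) (s : ℝ) :
    ∃ Y, Phi s ρ σ Y = Ffun (ov U W) (fun k => p k.1) (fun k => q k.2) s := by
  refine ⟨U * Matrix.of (fun i j => ((p i / (q j + s * p i) : ℝ) : ℂ) * (Uᴴ * W) i j) * Wᴴ, ?_⟩
  rw [Phi_eq h1 h2, Ffun]
  refine Finset.sum_congr rfl fun k _ => ?_
  have e : Uᴴ * (U * Matrix.of (fun i j => ((p i / (q j + s * p i) : ℝ) : ℂ) * (Uᴴ * W) i j) * Wᴴ) * W
      = Matrix.of (fun i j => ((p i / (q j + s * p i) : ℝ) : ℂ) * (Uᴴ * W) i j) := by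
    simp only [mul_assoc]
    rw [h2.left, mul_one, ← mul_assoc, h1.left, one_mul]
  rw [e, Matrix.of_apply, mul_assoc, Complex.mul_conj, Complex.normSq_mul, ← Complex.ofReal_mul,
    Complex.ofReal_re, Complex.normSq_ofReal, ov]
  by_cases hd : q k.2 + s * p k.1 = 0
  · simp [hd]
  · field_simp
    ring

lemma trace_split {n : Type*} [Fintype n] [DecidableEq n] {K L : Matrix n n ℂ}
    (hKL : Kᴴ * K + Lᴴ * L = 1) (σ : Matrix n n ℂ) :
    σ.trace = (K * σ * Kᴴ).trace + (L * σ * Lᴴ).trace := by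
  rw [trace_mul_comm _ Kᴴ, trace_mul_comm _ Lᴴ, ← trace_add, ← mul_assoc, ← mul_assoc, ← add_mul,
    hKL, one_mul]

lemma trace_quad_le {n : Type*} [Fintype n] [DecidableEq n] {K L : Matrix n n ℂ}
    (hKL : Kᴴ * K + Lᴴ * L = 1) {σ : Matrix n n ℂ} (hσ : σ.PosSemidef) (Y : Matrix n n ℂ) (c : ℝ) :
    ((Kᴴ * Y * K + (c : ℂ) • (Lᴴ * L)) * σ * (Kᴴ * Y * K + (c : ℂ) • (Lᴴ * L))ᴴ).trace.re ≤
      (Y * (K * σ * Kᴴ) * Yᴴ).trace.re + c ^ 2 * (σ.trace.re - (K * σ * Kᴴ).trace.re) := by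
  obtain ⟨N, rfl⟩ := psd_factor hσ
  have h := contr_ineq hKL (Y * K * Nᴴ) ((c : ℂ) • (L * Nᴴ))
  have e0 : Kᴴ * (Y * K * Nᴴ) + Lᴴ * ((c : ℂ) • (L * Nᴴ)) =
      (Kᴴ * Y * K + (c : ℂ) • (Lᴴ * L)) * Nᴴ := by
    simp only [add_mul, mul_assoc, Matrix.mul_smul, Matrix.smul_mul]
  rw [e0] at h
  have e1 : ((Kᴴ * Y * K + (c : ℂ) • (Lᴴ * L)) * (Nᴴ * N) *
      (Kᴴ * Y * K + (c : ℂ) • (Lᴴ * L))ᴴ).trace =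
      (((Kᴴ * Y * K + (c : ℂ) • (Lᴴ * L)) * Nᴴ)ᴴ *
        ((Kᴴ * Y * K + (c : ℂ) • (Lᴴ * L)) * Nᴴ)).trace := by
    rw [trace_mul_comm _ ((Kᴴ * Y * K + (c : ℂ) • (Lᴴ * L)) * Nᴴ), conjTranspose_mul,
      conjTranspose_conjTranspose]
    simp only [mul_assoc]
  have e2 : (Y * (K * (Nᴴ * N) * Kᴴ) * Yᴴ).trace = ((Y * K * Nᴴ)ᴴ * (Y * K * Nᴴ)).trace := by
    rw [trace_mul_comm _ (Y * K * Nᴴ)]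
    simp only [mul_assoc, conjTranspose_mul, conjTranspose_conjTranspose]
  have e3 : (((c : ℂ) • (L * Nᴴ))ᴴ * ((c : ℂ) • (L * Nᴴ))).trace.re =
      c ^ 2 * ((Nᴴ * N).trace.re - (K * (Nᴴ * N) * Kᴴ).trace.re) := by
    have : (Nᴴ * N).trace = (K * (Nᴴ * N) * Kᴴ).trace + ((L * Nᴴ)ᴴ * (L * Nᴴ)).trace := by
      rw [trace_split hKL (Nᴴ * N), trace_mul_comm _ (L * Nᴴ), conjTranspose_mul,
        conjTranspose_conjTranspose]
      simp only [mul_assoc]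
    rw [this, Complex.add_re, add_sub_cancel_left, conjTranspose_smul, Matrix.smul_mul,
      Matrix.mul_smul, smul_smul, trace_smul, RCLike.star_def, Complex.conj_ofReal, smul_eq_mul,
      ← Complex.ofReal_mul, Complex.re_ofReal_mul]
    ring
  rw [e1, e2]
  rw [e3] at h
  exact h

lemma F_mono {n : Type*} [Fintype n] [DecidableEq n] {K L : Matrix n n ℂ}
    (hKL : Kᴴ * K + Lᴴ * L = 1) {ρ σ U W U' W' : Matrix n n ℂ} {p q p' q' : n → ℝ}
    (h1 : Spec ρ U p) (h2 : Spec σ W q)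
    (h1' : Spec (K * ρ * Kᴴ) U' p') (h2' : Spec (K * σ * Kᴴ) W' q')
    (ht : ρ.trace.re = σ.trace.re) (ht' : (K * ρ * Kᴴ).trace.re = (K * σ * Kᴴ).trace.re)
    (s : ℝ) (hs : 0 < s) :
    Ffun (ov U' W') (fun k => p' k.1) (fun k => q' k.2) s - (K * ρ * Kᴴ).trace.re / (1 + s) ≤
      Ffun (ov U W) (fun k => p k.1) (fun k => q k.2) s - ρ.trace.re / (1 + s) := by
  obtain ⟨Y, hY⟩ := Phi_max h1' h2' s
  rw [← hY]
  set c : ℝ := 1 / (1 + s) with hc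
  set Y₀ := Kᴴ * Y * K + (c : ℂ) • (Lᴴ * L) with hY0
  have hle := Phi_le h1 h2 s hs Y₀
  have a1 := trace_quad_le hKL h2.psd Y c
  have a2 := trace_quad_le hKL h1.psd Yᴴ c
  have hY0h : Kᴴ * Yᴴ * K + (c : ℂ) • (Lᴴ * L) = Y₀ᴴ := by
    simp [hY0, mul_assoc]
  rw [← hY0] at a1
  rw [hY0h, conjTranspose_conjTranspose, conjTranspose_conjTranspose] at a2
  have a3 : (ρ * Y₀).trace.re = (K * ρ * Kᴴ * Y).trace.re +
      c * (ρ.trace.re - (K * ρ * Kᴴ).trace.re) := by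
    have t1 : (ρ * (Kᴴ * Y * K)).trace = (K * ρ * Kᴴ * Y).trace := by
      rw [← mul_assoc, trace_mul_comm]
      simp only [mul_assoc]
    have t2 : (ρ * (Lᴴ * L)).trace = (L * ρ * Lᴴ).trace := by
      rw [← mul_assoc, trace_mul_comm]
      simp only [mul_assoc]
    rw [hY0, mul_add, trace_add, Matrix.mul_smul, trace_smul, t1, t2, trace_split hKL ρ]
    simp
  unfold Phi at hle ⊢
  have e : c * (1 + s) = 1 := by rw [hc]; field_simp
  have e1 : ∀ x : ℝ, x / (1 + s) = c * x := fun x => by rw [hc]; ring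
  rw [e1, e1]
  set D := ρ.trace.re - (K * ρ * Kᴴ).trace.re with hD
  have hD' : σ.trace.re - (K * σ * Kᴴ).trace.re = D := by rw [hD, ht, ht']
  rw [hD'] at a1
  have e2 : c ^ 2 * D + s * (c ^ 2 * D) = c * D := by
    have : c ^ 2 * D + s * (c ^ 2 * D) = c * (c * (1 + s)) * D := by ring
    rw [this, e, mul_one]
  have a2' := mul_le_mul_of_nonneg_left a2 hs.le
  have e3 : c * ρ.trace.re = c * (K * ρ * Kᴴ).trace.re + c * D := by rw [hD]; ring
  nlinarith

/-- diagonal entries in the basis given by the columns of `W` -/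
def rd {n : Type*} [Fintype n] (ρ W : Matrix n n ℂ) (j : n) : ℝ := ((Wᴴ * ρ * W) j j).re

lemma rd_eq {n : Type*} [Fintype n] [DecidableEq n] {ρ U : Matrix n n ℂ} {p : n → ℝ}
    (h1 : Spec ρ U p) (W : Matrix n n ℂ) (j : n) : rd ρ W j = ∑ i, ov U W (i, j) * p i := by
  have : Wᴴ * ρ * W = (Uᴴ * W)ᴴ * (diagonal (fun i => (p i : ℂ)) * (Uᴴ * W)) := by
    rw [h1.eq]
    simp only [conjTranspose_mul, conjTranspose_conjTranspose, mul_assoc]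
  rw [rd, this, Matrix.mul_apply, Complex.re_sum]
  refine Finset.sum_congr rfl fun i _ => ?_
  rw [diagonal_mul, conjTranspose_apply, RCLike.star_def, mul_left_comm,
    mul_comm ((starRingEnd ℂ) _), Complex.mul_conj, ← Complex.ofReal_mul, Complex.ofReal_re, ov,
    mul_comm]

lemma ov_nonneg {n : Type*} [Fintype n] (U W : Matrix n n ℂ) (k : n × n) : 0 ≤ ov U W k :=
  Complex.normSq_nonneg _

lemma ov_row {n : Type*} [Fintype n] [DecidableEq n] {U W : Matrix n n ℂ}
    (hU : Uᴴ * U = 1) (hW : W * Wᴴ = 1) (i : n) : ∑ j, ov U W (i, j) = 1 := by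
  have : (Uᴴ * W) * (Uᴴ * W)ᴴ = 1 := by
    rw [conjTranspose_mul, conjTranspose_conjTranspose, mul_assoc, ← mul_assoc W, hW, one_mul, hU]
  have h := congrArg Complex.re (congrFun (congrFun this i) i)
  rw [Matrix.mul_apply, Complex.re_sum] at h
  simpa [Complex.mul_conj, ov, Complex.normSq_apply] using h

lemma ov_col {n : Type*} [Fintype n] [DecidableEq n] {U W : Matrix n n ℂ}
    (hU : U * Uᴴ = 1) (hW : Wᴴ * W = 1) (j : n) : ∑ i, ov U W (i, j) = 1 := by
  have : (Uᴴ * W)ᴴ * (Uᴴ * W) = 1 := by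
    rw [conjTranspose_mul, conjTranspose_conjTranspose, mul_assoc, ← mul_assoc U, hU, one_mul, hW]
  have h := congrArg Complex.re (congrFun (congrFun this j) j)
  rw [Matrix.mul_apply, Complex.re_sum] at h
  simpa [ov, Complex.normSq_apply] using h

lemma rel_eq {n : Type*} [Fintype n] [DecidableEq n] {ρ U W : Matrix n n ℂ} {p : n → ℝ}
    (h1 : Spec ρ U p) (hW : W * Wᴴ = 1) (q : n → ℝ) :
    ∑ k : n × n, ov U W k * p k.1 * (Real.log (p k.1) - Real.log (q k.2)) =
      - vN ρ - ∑ j, rd ρ W j * Real.log (q j) := by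
  have e1 : ∑ j, rd ρ W j * Real.log (q j) = ∑ k : n × n, ov U W k * p k.1 * Real.log (q k.2) := by
    rw [Fintype.sum_prod_type, Finset.sum_comm]
    refine Finset.sum_congr rfl fun j _ => ?_
    rw [rd_eq h1, Finset.sum_mul]
  have e2 : vN ρ = - ∑ k : n × n, ov U W k * p k.1 * Real.log (p k.1) := by
    rw [h1.vN, Fintype.sum_prod_type, ← Finset.sum_neg_distrib]
    refine Finset.sum_congr rfl fun i _ => ?_
    simp only [mul_assoc]
    rw [← Finset.sum_mul, ov_row h1.left hW, Real.negMulLog]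
    ring
  rw [e1, e2]
  simp only [mul_sub, Finset.sum_sub_distrib]
  ring

lemma supp_of_rd {n : Type*} [Fintype n] [DecidableEq n] {ρ U : Matrix n n ℂ} {p : n → ℝ}
    (h1 : Spec ρ U p) {W : Matrix n n ℂ} {k : n × n} (h : rd ρ W k.2 = 0) :
    ov U W k * p k.1 = 0 := by
  rw [rd_eq h1, Finset.sum_eq_zero_iff_of_nonneg
    (fun i _ => mul_nonneg (ov_nonneg _ _ _) (h1.nn i))] at h
  exact h k.1 (Finset.mem_univ _)

lemma sum_ov {n : Type*} [Fintype n] [DecidableEq n] {ρ U W : Matrix n n ℂ} {p : n → ℝ}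
    (h1 : Spec ρ U p) (hW : W * Wᴴ = 1) : ∑ k : n × n, ov U W k * p k.1 = ρ.trace.re := by
  rw [h1.trace, Fintype.sum_prod_type]
  refine Finset.sum_congr rfl fun i _ => ?_
  dsimp only
  rw [← Finset.sum_mul, ov_row h1.left hW, one_mul]

lemma core {n : Type*} [Fintype n] [DecidableEq n] {K L : Matrix n n ℂ}
    (hKL : Kᴴ * K + Lᴴ * L = 1) {ρ σ W W' : Matrix n n ℂ} {q q' : n → ℝ}
    (hρ : ρ.PosSemidef) (h2 : Spec σ W q) (h2' : Spec (K * σ * Kᴴ) W' q')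
    (ht : ρ.trace.re = σ.trace.re) (ht' : (K * ρ * Kᴴ).trace.re = (K * σ * Kᴴ).trace.re)
    (hs : ∀ j, q j = 0 → rd ρ W j = 0) (hs' : ∀ j, q' j = 0 → rd (K * ρ * Kᴴ) W' j = 0) :
    - vN (K * ρ * Kᴴ) - ∑ j, rd (K * ρ * Kᴴ) W' j * Real.log (q' j) ≤
      - vN ρ - ∑ j, rd ρ W j * Real.log (q j) := by
  obtain ⟨U, p, h1⟩ := exists_spec hρ
  obtain ⟨U', p', h1'⟩ := exists_spec (hρ.mul_mul_conjTranspose_same K)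
  rw [← rel_eq h1 h2.right, ← rel_eq h1' h2'.right]
  refine rel_mono _ (fun k : n × n => p k.1) (fun k => q k.2) _ (fun k : n × n => p' k.1)
    (fun k => q' k.2) (fun k => h1.nn _) (fun k => h2.nn _) (fun k h => supp_of_rd h1 (hs _ h))
    (fun k => h1'.nn _) (fun k => h2'.nn _) (fun k h => supp_of_rd h1' (hs' _ h)) ?_
  intro s hs
  rw [sum_ov h1 h2.right, sum_ov h1' h2'.right]
  exact F_mono hKL h1 h2 h1' h2' ht ht' s hs

lemma klein {n : Type*} [Fintype n] [DecidableEq n] {ρ σ W : Matrix n n ℂ} {q : n → ℝ}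
    (hρ : ρ.PosSemidef) (h2 : Spec σ W q) (ht : σ.trace.re = 1)
    (hs : ∀ j, q j = 0 → rd ρ W j = 0) :
    - Real.negMulLog ρ.trace.re ≤ - vN ρ - ∑ j, rd ρ W j * Real.log (q j) := by
  obtain ⟨U, p, h1⟩ := exists_spec hρ
  rw [← rel_eq h1 h2.right]
  set t := ρ.trace.re with htt
  have ht0 : 0 ≤ t := (Complex.le_def.1 hρ.trace_nonneg).1
  have e1 : ∑ k : n × n, ov U W k * q k.2 = 1 := by
    rw [← ht, h2.trace, Fintype.sum_prod_type, Finset.sum_comm]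
    refine Finset.sum_congr rfl fun i _ => ?_
    dsimp only
    rw [← Finset.sum_mul, ov_col h1.right h2.left, one_mul]
  have e2 : - Real.negMulLog t = ∑ k : n × n, (ov U W k * p k.1 * Real.log t +
      (ov U W k * p k.1 - t * (ov U W k * q k.2))) := by
    rw [Finset.sum_add_distrib, Finset.sum_sub_distrib, ← Finset.sum_mul, ← Finset.mul_sum, e1,
      sum_ov h1 h2.right, Real.negMulLog]
    ring
  rw [e2]
  refine Finset.sum_le_sum fun k _ => ?_
  have hm := ov_nonneg U W k
  have hp := h1.nn k.1
  have hq := h2.nn k.2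
  rcases (mul_nonneg hm hp).eq_or_lt with h | h
  · rw [← h]
    have := mul_nonneg ht0 (mul_nonneg hm hq)
    linarith
  have hq' : 0 < q k.2 := by
    refine lt_of_le_of_ne hq fun h0 => ?_
    have := supp_of_rd h1 (hs k.2 h0.symm)
    exact h.ne' this
  have hp' : 0 < p k.1 := pos_of_mul_pos_right h hm
  have ht' : 0 < t := by
    rw [htt, h1.trace]
    exact lt_of_lt_of_le hp' (Finset.single_le_sum (fun i _ => h1.nn i) (Finset.mem_univ _))
  have hl := Real.log_le_sub_one_of_pos (show 0 < t * q k.2 / p k.1 by positivity)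
  rw [Real.log_div (by positivity) hp'.ne', Real.log_mul ht'.ne' hq'.ne'] at hl
  have := mul_le_mul_of_nonneg_left hl (mul_nonneg hm hp)
  have e3 : ov U W k * p k.1 * (t * q k.2 / p k.1 - 1) =
      t * (ov U W k * q k.2) - ov U W k * p k.1 := by
    field_simp
  rw [e3] at this
  linarith

/-! ### Partial traces -/

section ptr
variable {a b : Type*} [Fintype a] [Fintype b] [DecidableEq a] [DecidableEq b]

lemma trace_ptrA (ρ : Matrix (a × b) (a × b) ℂ) : (ptrA ρ).trace = ρ.trace := by
  simp only [trace, diag_apply, ptrA, Matrix.of_apply, Fintype.sum_prod_type]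
  exact Finset.sum_comm

lemma trace_ptrB (ρ : Matrix (a × b) (a × b) ℂ) : (ptrB ρ).trace = ρ.trace := by
  simp only [trace, diag_apply, ptrB, Matrix.of_apply, Fintype.sum_prod_type]

lemma trace_mul_ptrA (ρ : Matrix (a × b) (a × b) ℂ) (M : Matrix b b ℂ) :
    (ρ * ((1 : Matrix a a ℂ) ⊗ₖ M)).trace = (ptrA ρ * M).trace := by
  simp only [trace, diag_apply, ptrA, Matrix.mul_apply, Matrix.of_apply, Fintype.sum_prod_type,
    kroneckerMap_apply, Matrix.one_apply, ite_mul, one_mul, zero_mul, mul_ite, mul_zero,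
    Finset.sum_mul]
  rw [Finset.sum_comm]
  refine Finset.sum_congr rfl fun j _ => ?_
  rw [Finset.sum_comm (γ := b)]
  refine Finset.sum_congr rfl fun i _ => ?_
  rw [Finset.sum_comm]
  refine Finset.sum_congr rfl fun j' _ => ?_
  simp

lemma trace_mul_ptrB (ρ : Matrix (a × b) (a × b) ℂ) (M : Matrix a a ℂ) :
    (ρ * (M ⊗ₖ (1 : Matrix b b ℂ))).trace = (ptrB ρ * M).trace := by
  simp only [trace, diag_apply, ptrB, Matrix.mul_apply, Matrix.of_apply, Fintype.sum_prod_type,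
    kroneckerMap_apply, Matrix.one_apply, ite_mul, one_mul, zero_mul, mul_ite, mul_zero, mul_one,
    Finset.sum_mul]
  refine Finset.sum_congr rfl fun i _ => ?_
  rw [Finset.sum_comm]
  refine Finset.sum_congr rfl fun i' _ => ?_
  refine Finset.sum_congr rfl fun j _ => ?_
  simp

lemma ptrA_kron (ρ : Matrix (a × b) (a × b) ℂ) (X : Matrix a a ℂ) (Y : Matrix b b ℂ)
    (hX : Xᴴ * X = 1) : ptrA ((X ⊗ₖ Y) * ρ * (X ⊗ₖ Y)ᴴ) = Y * ptrA ρ * Yᴴ := by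
  refine Matrix.ext_iff_trace_mul_right.2 fun M => ?_
  rw [← trace_mul_ptrA, conjTranspose_kronecker, mul_assoc, ← mul_kronecker_mul, mul_one,
    mul_assoc, trace_mul_comm, mul_assoc, ← mul_kronecker_mul, hX, trace_mul_ptrA, ← mul_assoc,
    trace_mul_comm]
  simp only [mul_assoc]

lemma ptrB_kron (ρ : Matrix (a × b) (a × b) ℂ) (X : Matrix a a ℂ) (Y : Matrix b b ℂ)
    (hY : Yᴴ * Y = 1) : ptrB ((X ⊗ₖ Y) * ρ * (X ⊗ₖ Y)ᴴ) = X * ptrB ρ * Xᴴ := by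
  refine Matrix.ext_iff_trace_mul_right.2 fun M => ?_
  rw [← trace_mul_ptrB, conjTranspose_kronecker, mul_assoc, ← mul_kronecker_mul, mul_one,
    mul_assoc, trace_mul_comm, mul_assoc, ← mul_kronecker_mul, hY, trace_mul_ptrB, ← mul_assoc,
    trace_mul_comm]
  simp only [mul_assoc]

lemma ptrA_split (ρ : Matrix (a × b) (a × b) ℂ) {V L : Matrix a a ℂ}
    (h : Vᴴ * V + Lᴴ * L = 1) :
    ptrA ρ = ptrA ((V ⊗ₖ (1 : Matrix b b ℂ)) * ρ * (V ⊗ₖ (1 : Matrix b b ℂ))ᴴ) +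
      ptrA ((L ⊗ₖ (1 : Matrix b b ℂ)) * ρ * (L ⊗ₖ (1 : Matrix b b ℂ))ᴴ) := by
  refine Matrix.ext_iff_trace_mul_right.2 fun M => ?_
  have key : ∀ X : Matrix a a ℂ,
      (ptrA ((X ⊗ₖ (1 : Matrix b b ℂ)) * ρ * (X ⊗ₖ (1 : Matrix b b ℂ))ᴴ) * M).trace =
      (ρ * ((Xᴴ * X) ⊗ₖ M)).trace := by
    intro X
    rw [← trace_mul_ptrA, conjTranspose_kronecker, mul_assoc, ← mul_kronecker_mul, mul_one,
      mul_assoc, trace_mul_comm, mul_assoc, ← mul_kronecker_mul]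
    simp
  rw [add_mul, trace_add, key, key, ← trace_mul_ptrA, ← h, add_kronecker, mul_add, trace_add]

lemma ptrA_psd {ρ : Matrix (a × b) (a × b) ℂ} (h : ρ.PosSemidef) : (ptrA ρ).PosSemidef := by
  have : ptrA ρ = ∑ i, ρ.submatrix (fun j => (i, j)) (fun j => (i, j)) := by
    ext j j'
    simp [ptrA, Matrix.sum_apply]
  rw [this]
  exact posSemidef_sum _ fun i _ => h.submatrix _

lemma ptrB_psd {ρ : Matrix (a × b) (a × b) ℂ} (h : ρ.PosSemidef) : (ptrB ρ).PosSemidef := by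
  have : ptrB ρ = ∑ j, ρ.submatrix (fun i => (i, j)) (fun i => (i, j)) := by
    ext j j'
    simp [ptrB, Matrix.sum_apply]
  rw [this]
  exact posSemidef_sum _ fun i _ => h.submatrix _

lemma rd_nonneg {n : Type*} [Fintype n] [DecidableEq n] {ρ : Matrix n n ℂ} (h : ρ.PosSemidef)
    (W : Matrix n n ℂ) (j : n) : 0 ≤ rd ρ W j := by
  obtain ⟨U, p, hs⟩ := exists_spec h
  rw [rd_eq hs]
  exact Finset.sum_nonneg fun i _ => mul_nonneg (ov_nonneg _ _ _) (hs.nn i)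

lemma Spec.rd {n : Type*} [Fintype n] [DecidableEq n] {ρ U : Matrix n n ℂ} {p : n → ℝ}
    (h : Spec ρ U p) (j : n) : rd ρ U j = p j := by
  have : Uᴴ * ρ * U = diagonal (fun i => (p i : ℂ)) := by
    rw [h.eq]
    simp only [mul_assoc]
    rw [h.left, mul_one, ← mul_assoc, h.left, one_mul]
  rw [_root_.rd, this, diagonal_apply_eq, Complex.ofReal_re]

lemma Spec.kron {A U : Matrix a a ℂ} {B W : Matrix b b ℂ} {p : a → ℝ} {q : b → ℝ}
    (h1 : Spec A U p) (h2 : Spec B W q) :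
    Spec (A ⊗ₖ B) (U ⊗ₖ W) (fun k => p k.1 * q k.2) := by
  refine ⟨?_, ?_, ?_, fun k => mul_nonneg (h1.nn _) (h2.nn _)⟩
  · rw [conjTranspose_kronecker, ← mul_kronecker_mul, h1.left, h2.left, one_kronecker_one]
  · rw [conjTranspose_kronecker, ← mul_kronecker_mul, h1.right, h2.right, one_kronecker_one]
  · conv_lhs => rw [h1.eq, h2.eq]
    rw [conjTranspose_kronecker, mul_kronecker_mul, mul_kronecker_mul,
      diagonal_kronecker_diagonal]
    simp

lemma rd_sumB (ρ : Matrix (a × b) (a × b) ℂ) (U : Matrix a a ℂ) {W : Matrix b b ℂ}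
    (hW : W * Wᴴ = 1) (k : a) : ∑ l, rd ρ (U ⊗ₖ W) (k, l) = rd (ptrB ρ) U k := by
  have := ptrB_kron ρ Uᴴ Wᴴ (by simpa using hW)
  rw [← conjTranspose_kronecker, conjTranspose_conjTranspose, conjTranspose_conjTranspose] at this
  unfold rd
  rw [← this, ptrB, Matrix.of_apply, Complex.re_sum]

lemma rd_sumA (ρ : Matrix (a × b) (a × b) ℂ) {U : Matrix a a ℂ} (W : Matrix b b ℂ)
    (hU : U * Uᴴ = 1) (l : b) : ∑ k, rd ρ (U ⊗ₖ W) (k, l) = rd (ptrA ρ) W l := by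
  have := ptrA_kron ρ Uᴴ Wᴴ (by simpa using hU)
  rw [← conjTranspose_kronecker, conjTranspose_conjTranspose, conjTranspose_conjTranspose] at this
  unfold rd
  rw [← this, ptrA, Matrix.of_apply, Complex.re_sum]

lemma prod_supp {ρ : Matrix (a × b) (a × b) ℂ} (hρ : ρ.PosSemidef) {U : Matrix a a ℂ}
    {α : a → ℝ} (h1 : Spec (ptrB ρ) U α) {W : Matrix b b ℂ} (hW : W * Wᴴ = 1) {β : b → ℝ}
    (hs : ∀ l, β l = 0 → rd (ptrA ρ) W l = 0) (k : a × b) (h0 : α k.1 * β k.2 = 0) :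
    rd ρ (U ⊗ₖ W) k = 0 := by
  rcases mul_eq_zero.1 h0 with h | h
  · have := rd_sumB ρ U hW k.1
    rw [h1.rd, h, Finset.sum_eq_zero_iff_of_nonneg (fun _ _ => rd_nonneg hρ _ _)] at this
    exact this k.2 (Finset.mem_univ _)
  · have := rd_sumA ρ W h1.right k.2
    rw [hs _ h, Finset.sum_eq_zero_iff_of_nonneg (fun _ _ => rd_nonneg hρ _ _)] at this
    exact this k.1 (Finset.mem_univ _)

lemma prod_log {ρ : Matrix (a × b) (a × b) ℂ} (hρ : ρ.PosSemidef) {U : Matrix a a ℂ}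
    {α : a → ℝ} (h1 : Spec (ptrB ρ) U α) {W : Matrix b b ℂ} (hW : W * Wᴴ = 1) {β : b → ℝ}
    (hs : ∀ l, β l = 0 → rd (ptrA ρ) W l = 0) :
    ∑ k : a × b, rd ρ (U ⊗ₖ W) k * Real.log (α k.1 * β k.2) =
      - vN (ptrB ρ) + ∑ l, rd (ptrA ρ) W l * Real.log (β l) := by
  have e1 : ∑ k : a × b, rd ρ (U ⊗ₖ W) k * Real.log (α k.1 * β k.2) =
      ∑ k : a × b, (rd ρ (U ⊗ₖ W) k * Real.log (α k.1) + rd ρ (U ⊗ₖ W) k * Real.log (β k.2)) := by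
    refine Finset.sum_congr rfl fun k _ => ?_
    by_cases h : α k.1 * β k.2 = 0
    · simp [prod_supp hρ h1 hW hs k h]
    · rw [Real.log_mul (left_ne_zero_of_mul h) (right_ne_zero_of_mul h), mul_add]
  rw [e1, Finset.sum_add_distrib]
  congr 1
  · rw [Fintype.sum_prod_type, h1.vN, ← Finset.sum_neg_distrib]
    refine Finset.sum_congr rfl fun k _ => ?_
    dsimp only
    rw [← Finset.sum_mul, rd_sumB ρ U hW, h1.rd, Real.negMulLog]
    ring
  · rw [Fintype.sum_prod_type, Finset.sum_comm]
    refine Finset.sum_congr rfl fun k _ => ?_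
    dsimp only
    rw [← Finset.sum_mul, rd_sumA ρ W h1.right]

lemma rd_add {n : Type*} [Fintype n] (A B W : Matrix n n ℂ) (j : n) :
    rd (A + B) W j = rd A W j + rd B W j := by
  simp [rd, mul_add, add_mul]

lemma mono_aux {ω : Matrix (a × b) (a × b) ℂ} (hω : IsDensity ω)
    {V : Matrix a a ℂ} (hV : ((1 : Matrix a a ℂ) - Vᴴ * V).PosSemidef)
    {ω' : Matrix (a × b) (a × b) ℂ}
    (hω' : ω' = (V ⊗ₖ (1 : Matrix b b ℂ)) * ω * (V ⊗ₖ (1 : Matrix b b ℂ))ᴴ) :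
    vN (ptrB ω') + vN (ptrA ω') - vN ω' - Real.negMulLog ω'.trace.re ≤ mutInfo ω := by
  obtain ⟨L, hL⟩ := psd_factor hV
  have hVL : Vᴴ * V + Lᴴ * L = 1 := by rw [← hL]; abel
  have hKL : (V ⊗ₖ (1 : Matrix b b ℂ))ᴴ * (V ⊗ₖ (1 : Matrix b b ℂ)) +
      (L ⊗ₖ (1 : Matrix b b ℂ))ᴴ * (L ⊗ₖ (1 : Matrix b b ℂ)) = 1 := by
    rw [conjTranspose_kronecker, conjTranspose_kronecker, ← mul_kronecker_mul,
      ← mul_kronecker_mul, ← add_kronecker, hVL]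
    simp
  obtain ⟨hω0, hω1⟩ := hω
  have hp' : ω'.PosSemidef := hω' ▸ hω0.mul_mul_conjTranspose_same _
  have hB' : ptrB ω' = V * ptrB ω * Vᴴ := by
    rw [hω']
    exact ptrB_kron _ _ _ (by simp)
  obtain ⟨U, α, h1⟩ := exists_spec (ptrB_psd hω0)
  obtain ⟨U', α', h1'⟩ := exists_spec (ptrB_psd hp')
  obtain ⟨W, β, h2⟩ := exists_spec (ptrA_psd hω0)
  have hs : ∀ l, β l = 0 → rd (ptrA ω) W l = 0 := fun l h => by rw [h2.rd, h]
  have hs' : ∀ l, β l = 0 → rd (ptrA ω') W l = 0 := by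
    intro l h
    have := hs l h
    rw [ptrA_split ω hVL, rd_add, ← hω'] at this
    have p1 := rd_nonneg (ptrA_psd hp') W l
    have p2 := rd_nonneg (ptrA_psd (hω0.mul_mul_conjTranspose_same
      (L ⊗ₖ (1 : Matrix b b ℂ)))) W l
    linarith
  have hσ' : (V ⊗ₖ (1 : Matrix b b ℂ)) * (ptrB ω ⊗ₖ ptrA ω) * (V ⊗ₖ (1 : Matrix b b ℂ))ᴴ =
      ptrB ω' ⊗ₖ ptrA ω := by
    rw [hB', conjTranspose_kronecker, ← mul_kronecker_mul, ← mul_kronecker_mul]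
    simp
  have hc := core hKL (ρ := ω) (σ := ptrB ω ⊗ₖ ptrA ω) hω0 (h1.kron h2) (by
      rw [hσ']; exact h1'.kron h2) (by rw [trace_kronecker, trace_ptrA, trace_ptrB, hω1, mul_one])
      (by rw [hσ', trace_kronecker, trace_ptrA, trace_ptrB, hω1, mul_one, hω'])
      (fun k h => prod_supp hω0 h1 h2.right hs k h)
      (by rw [← hω']; exact fun k h => prod_supp hp' h1' h2.right hs' k h)
  rw [← hω', prod_log hω0 h1 h2.right hs, prod_log hp' h1' h2.right hs'] at hc
  have hk := klein (ptrA_psd hp') h2 (by rw [trace_ptrA, hω1]; simp) hs'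
  rw [trace_ptrA] at hk
  have hv : ∑ l, rd (ptrA ω) W l * Real.log (β l) = - vN (ptrA ω) := by
    rw [h2.vN, ← Finset.sum_neg_distrib]
    refine Finset.sum_congr rfl fun k _ => ?_
    rw [h2.rd, Real.negMulLog]
    ring
  rw [hv] at hc
  rw [mutInfo]
  linarith

lemma vN_scale {n : Type*} [Fintype n] [DecidableEq n] {A : Matrix n n ℂ} (h : A.PosSemidef)
    {t : ℝ} (ht : A.trace.re = t) :
    t * vN (((t : ℂ))⁻¹ • A) = vN A - Real.negMulLog t := by
  obtain ⟨U, p, hs⟩ := exists_spec h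
  have ht0 : 0 ≤ t := ht ▸ (Complex.le_def.1 h.trace_nonneg).1
  have hsum : ∑ i, p i = t := by rw [← ht, hs.trace]
  have hs' : Spec (((t : ℂ))⁻¹ • A) U (fun i => t⁻¹ * p i) := by
    refine ⟨hs.left, hs.right, ?_, fun i => mul_nonneg (inv_nonneg.2 ht0) (hs.nn i)⟩
    conv_lhs => rw [hs.eq]
    rw [← Matrix.smul_mul, ← Matrix.mul_smul, ← diagonal_smul]
    congr 3
    ext i
    simp
  rw [hs'.vN, hs.vN]
  rcases ht0.eq_or_lt with h0 | h0
  · rw [← h0] at hsum ⊢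
    rw [Finset.sum_eq_zero_iff_of_nonneg (fun i _ => hs.nn i)] at hsum
    simp only [Finset.mem_univ, forall_const] at hsum
    simp [hsum]
  · simp only [Real.negMulLog_mul, Finset.sum_add_distrib, ← Finset.mul_sum, ← Finset.sum_mul]
    rw [hsum]
    simp only [Real.negMulLog, Real.log_inv]
    field_simp
    ring

lemma mutInfoExt_eq {ρ : Matrix (a × b) (a × b) ℂ} (h : ρ.PosSemidef) :
    mutInfoExt ρ = vN (ptrB ρ) + vN (ptrA ρ) - vN ρ - Real.negMulLog ρ.trace.re := by
  have eA : ∀ c : ℂ, ptrA (c • ρ) = c • ptrA ρ := by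
    intro c; ext i j; simp [ptrA, Finset.mul_sum]
  have eB : ∀ c : ℂ, ptrB (c • ρ) = c • ptrB ρ := by
    intro c; ext i j; simp [ptrB, Finset.mul_sum]
  have h1 := vN_scale h rfl
  have h2 := vN_scale (ptrA_psd h) (congrArg Complex.re (trace_ptrA ρ))
  have h3 := vN_scale (ptrB_psd h) (congrArg Complex.re (trace_ptrB ρ))
  rw [mutInfoExt, mutInfo, eA, eB, mul_sub, mul_add, h1, h2, h3]
  ring

lemma first_ineq {ω : Matrix (a × b) (a × b) ℂ} (hω : IsDensity ω)
    {V : Matrix a a ℂ} (hV : ((1 : Matrix a a ℂ) - Vᴴ * V).PosSemidef) :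
    mutInfoExt ((V ⊗ₖ (1 : Matrix b b ℂ)) * ω * (V ⊗ₖ (1 : Matrix b b ℂ))ᴴ) ≤ mutInfo ω := by
  rw [mutInfoExt_eq (hω.1.mul_mul_conjTranspose_same _)]
  exact mono_aux hω hV rfl

/-! ### Purification -/

lemma vN_comm {m n : Type*} [Fintype m] [DecidableEq m] [Fintype n] [DecidableEq n]
    (X : Matrix m n ℂ) : vN (X * Xᴴ) = vN (Xᴴ * X)ᵀ := by
  rw [vN_roots (posSemidef_self_mul_conjTranspose X).1,
    vN_roots (posSemidef_conjTranspose_mul_self X).transpose.1, charpoly_transpose]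
  have h := congrArg Polynomial.roots (charpoly_mul_comm' X Xᴴ)
  rw [Polynomial.roots_mul (mul_ne_zero (pow_ne_zero _ Polynomial.X_ne_zero)
      (charpoly_monic _).ne_zero),
    Polynomial.roots_mul (mul_ne_zero (pow_ne_zero _ Polynomial.X_ne_zero)
      (charpoly_monic _).ne_zero), Polynomial.roots_X_pow, Polynomial.roots_X_pow] at h
  have h2 := congrArg (fun s => (Multiset.map (fun z : ℂ => Real.negMulLog z.re) s).sum) h
  simpa [Multiset.map_nsmul, Multiset.sum_nsmul] using h2

/-- reshuffling of a tripartite vector -/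
def resh {r : Type*} (M : Matrix (a × b) r ℂ) : Matrix (a × r) b ℂ :=
  Matrix.of fun x j => M (x.1, j) x.2

lemma ptrB_resh {r : Type*} [Fintype r] (M : Matrix (a × b) r ℂ) :
    ptrB (resh M * (resh M)ᴴ) = ptrB (M * Mᴴ) := by
  ext i i'
  simp only [ptrB, resh, Matrix.mul_apply, Matrix.of_apply, conjTranspose_apply]
  exact Finset.sum_comm

lemma ptrA_resh {r : Type*} [Fintype r] (M : Matrix (a × b) r ℂ) :
    ptrA (resh M * (resh M)ᴴ) = (Mᴴ * M)ᵀ := by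
  ext i i'
  simp only [ptrA, resh, Matrix.mul_apply, Matrix.of_apply, conjTranspose_apply, transpose_apply,
    Fintype.sum_prod_type]
  exact Finset.sum_congr rfl fun _ _ => Finset.sum_congr rfl fun _ _ => mul_comm _ _

lemma ptrA_eq_resh {r : Type*} [Fintype r] (M : Matrix (a × b) r ℂ) :
    ptrA (M * Mᴴ) = ((resh M)ᴴ * resh M)ᵀ := by
  ext i i'
  simp only [ptrA, resh, Matrix.mul_apply, Matrix.of_apply, conjTranspose_apply, transpose_apply,
    Fintype.sum_prod_type]
  exact Finset.sum_congr rfl fun _ _ => Finset.sum_congr rfl fun _ _ => mul_comm _ _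

lemma resh_kron {r : Type*} [Fintype r] [DecidableEq r] (V : Matrix a a ℂ)
    (M : Matrix (a × b) r ℂ) :
    resh ((V ⊗ₖ (1 : Matrix b b ℂ)) * M) = (V ⊗ₖ (1 : Matrix r r ℂ)) * resh M := by
  ext i j
  simp [resh, Matrix.mul_apply, Fintype.sum_prod_type, Matrix.one_apply]

lemma mutInfo_resh {r : Type*} [Fintype r] [DecidableEq r] (M : Matrix (a × b) r ℂ) :
    mutInfo (M * Mᴴ) + mutInfo (resh M * (resh M)ᴴ) = 2 * vN (ptrB (M * Mᴴ)) := by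
  rw [mutInfo, mutInfo, ptrB_resh, ptrA_resh, ptrA_eq_resh, ← vN_comm, ← vN_comm]
  ring

lemma mutInfoExt_resh {r : Type*} [Fintype r] [DecidableEq r] (M : Matrix (a × b) r ℂ) :
    mutInfoExt (M * Mᴴ) + mutInfoExt (resh M * (resh M)ᴴ) = 2 * entExt (ptrB (M * Mᴴ)) := by
  have ht : (resh M * (resh M)ᴴ).trace = (M * Mᴴ).trace := by
    rw [← trace_ptrB, ptrB_resh, trace_ptrB]
  rw [mutInfoExt_eq (posSemidef_self_mul_conjTranspose M),
    mutInfoExt_eq (posSemidef_self_mul_conjTranspose (resh M)), entExt, ht, trace_ptrB,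
    ptrB_resh, ptrA_resh, ptrA_eq_resh, ← vN_comm, ← vN_comm]
  ring

end ptr

theorem stmt5 {a b : Type*} [Fintype a] [Fintype b] [DecidableEq a] [DecidableEq b]
    (ω : Matrix (a × b) (a × b) ℂ) (hω : IsDensity ω)
    (V : Matrix a a ℂ) (hV : ((1 : Matrix a a ℂ) - Vᴴ * V).PosSemidef) :
    0 ≤ mutInfo ω - mutInfoExt ((V ⊗ₖ (1 : Matrix b b ℂ)) * ω * (V ⊗ₖ (1 : Matrix b b ℂ))ᴴ) ∧
    mutInfo ω - mutInfoExt ((V ⊗ₖ (1 : Matrix b b ℂ)) * ω * (V ⊗ₖ (1 : Matrix b b ℂ))ᴴ) ≤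
      2 * (vN (ptrB ω) - entExt (V * ptrB ω * Vᴴ)) := by
  refine ⟨sub_nonneg.2 (first_ineq hω hV), ?_⟩
  obtain ⟨N, hN⟩ := psd_factor hω.1
  have hM : ω = Nᴴ * Nᴴᴴ := by rw [conjTranspose_conjTranspose]; exact hN
  generalize Nᴴ = M at hM
  have hω' : IsDensity (resh M * (resh M)ᴴ) := by
    refine ⟨posSemidef_self_mul_conjTranspose _, ?_⟩
    rw [← trace_ptrB, ptrB_resh, trace_ptrB, ← hM]
    exact hω.2
  have h1 := first_ineq hω' hV
  have e1 : (V ⊗ₖ (1 : Matrix (a × b) (a × b) ℂ)) * (resh M * (resh M)ᴴ) *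
      (V ⊗ₖ (1 : Matrix (a × b) (a × b) ℂ))ᴴ =
      resh ((V ⊗ₖ (1 : Matrix b b ℂ)) * M) * (resh ((V ⊗ₖ (1 : Matrix b b ℂ)) * M))ᴴ := by
    rw [resh_kron, conjTranspose_mul]
    simp only [Matrix.mul_assoc]
  have e2 : (V ⊗ₖ (1 : Matrix b b ℂ)) * ω * (V ⊗ₖ (1 : Matrix b b ℂ))ᴴ =
      ((V ⊗ₖ (1 : Matrix b b ℂ)) * M) * ((V ⊗ₖ (1 : Matrix b b ℂ)) * M)ᴴ := by
    rw [hM, conjTranspose_mul]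
    simp only [Matrix.mul_assoc]
  have h2 := mutInfo_resh M
  have h3 := mutInfoExt_resh ((V ⊗ₖ (1 : Matrix b b ℂ)) * M)
  have e3 : ptrB ((V ⊗ₖ (1 : Matrix b b ℂ)) * ω * (V ⊗ₖ (1 : Matrix b b ℂ))ᴴ) =
      V * ptrB ω * Vᴴ := ptrB_kron _ _ _ (by simp)
  rw [← e2, e3] at h3
  rw [← hM] at h2
  rw [e1] at h1
  linarith

end
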